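/- Every uplifting cardinal κ is pseudo uplifting and is a limit of pseudo uplifting cardinals: κ is itself pseudo uplifting, and for every ordinal θ < κ there is a pseudo uplifting cardinal β with θ < β < κ. -/

import Mathlib

open FirstOrder Language

universe u

namespace Paper

/-- The language of set theory: a single binary relation symbol (membership).
We reuse `FirstOrder.Language.graph`, whose sole symbol is a binary relation. -/
abbrev LSet : FirstOrder.Language := FirstOrder.Language.graph

/-- The rank-initial segment `V_α` of the cumulative hierarchy, realized as the
collection of ZF sets of rank less than `α`. -/
abbrev Vt (α : Ordinal) : Type 1 := {x : ZFSet // x.rank < α}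

/-- `V_α` as a structure in the language of set theory, with the membership relation. -/
instance VtStructure (α : Ordinal) : LSet.Structure (Vt α) where
  funMap := fun f _ => f.elim
  RelMap := fun r x => match r with | .adj => (x 0).1 ∈ (x 1).1

/-- The universe of sets as a structure in the language of set theory. -/
instance ZFSetStructure : LSet.Structure ZFSet where
  funMap := fun f _ => f.elim
  RelMap := fun r x => match r with | .adj => x 0 ∈ x 1

/-- `V_α ≺ V_β`: the inclusion of `V_α` into `V_β` is an elementary embedding. -/
def VElem (α β : Ordinal) : Prop :=
  ∃ e : Vt α ↪ₑ[LSet] Vt β, ∀ x : Vt α, (e x : ZFSet) = x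

/-- An ordinal which is a cardinal. -/
def IsCardOrd (γ : Ordinal) : Prop := γ.card.ord = γ

/-- An ordinal which is a regular cardinal. -/
def IsRegularOrd (γ : Ordinal) : Prop := γ.card.IsRegular ∧ γ.card.ord = γ

/-- An ordinal which is an inaccessible cardinal (uncountable, regular, strong limit). -/
def IsInaccOrd (γ : Ordinal) : Prop := γ.card.IsInaccessible ∧ γ.card.ord = γ

/-- An inaccessible cardinal `κ` is uplifting if for every ordinal `θ` there is an
inaccessible cardinal `γ ≥ θ` such that `V_κ ≺ V_γ` is a proper elementary extension. -/
def IsUplifting (κ : Ordinal) : Prop :=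
  IsInaccOrd κ ∧ ∀ θ : Ordinal, ∃ γ : Ordinal, IsInaccOrd γ ∧ θ ≤ γ ∧ κ < γ ∧ VElem κ γ

/-- An inaccessible cardinal `κ` is pseudo uplifting if for every ordinal `θ` there is a
cardinal `γ ≥ θ` such that `V_κ ≺ V_γ` is a proper elementary extension. -/
def IsPseudoUplifting (κ : Ordinal) : Prop :=
  IsInaccOrd κ ∧ ∀ θ : Ordinal, ∃ γ : Ordinal, IsCardOrd γ ∧ θ ≤ γ ∧ κ < γ ∧ VElem κ γ

/-! ### Predicates on sets that are definable and absolute for the levels `V_γ` -/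

/-- A predicate on tuples of sets is absolute if a single formula defines it in every `V_γ` with
`γ` a limit ordinal. -/
def IsAbsolute {n : ℕ} (P : (Fin n → ZFSet.{0}) → Prop) : Prop :=
  ∃ φ : LSet.BoundedFormula Empty n, ∀ γ : Ordinal.{0}, Order.IsSuccLimit γ →
    ∀ v : Fin n → Vt γ, φ.Realize default v ↔ P fun i => v i

/-- A function on tuples which is a coordinate projection. -/
def IsVar {n : ℕ} (t : (Fin n → ZFSet.{0}) → ZFSet.{0}) : Prop :=
  ∃ i, ∀ v, t v = v i

theorem IsVar.proj {n : ℕ} (i : Fin n) : IsVar fun v => v i := ⟨i, fun _ => rfl⟩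

theorem IsVar.init {n : ℕ} {t : (Fin n → ZFSet.{0}) → ZFSet.{0}} (h : IsVar t) :
    IsVar fun v : Fin (n + 1) → ZFSet => t (Fin.init v) := by
  obtain ⟨i, hi⟩ := h
  exact ⟨i.castSucc, fun v => hi _⟩

theorem IsVar.rank_lt {n : ℕ} {t : (Fin n → ZFSet.{0}) → ZFSet.{0}} (h : IsVar t)
    {γ : Ordinal.{0}} (v : Fin n → Vt γ) : (t fun i => v i).rank < γ := by
  obtain ⟨i, hi⟩ := h
  rw [hi]
  exact (v i).2

theorem IsAbsolute.congr {n : ℕ} {P Q : (Fin n → ZFSet.{0}) → Prop} (hP : IsAbsolute P)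
    (h : ∀ v, Q v ↔ P v) : IsAbsolute Q := by
  obtain ⟨φ, hφ⟩ := hP
  exact ⟨φ, fun γ hγ v => (hφ γ hγ v).trans (h _).symm⟩

theorem IsAbsolute.mem {n : ℕ} {s t : (Fin n → ZFSet.{0}) → ZFSet.{0}} (hs : IsVar s)
    (ht : IsVar t) : IsAbsolute fun v => s v ∈ t v := by
  obtain ⟨i, hi⟩ := hs
  obtain ⟨j, hj⟩ := ht
  refine ⟨Relations.boundedFormula₂ (L := LSet) adj (Term.var (.inr i)) (Term.var (.inr j)),
    fun γ _ v => ?_⟩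
  rw [BoundedFormula.realize_rel₂]
  simp only [hi, hj]
  rfl

theorem IsAbsolute.eq {n : ℕ} {s t : (Fin n → ZFSet.{0}) → ZFSet.{0}} (hs : IsVar s)
    (ht : IsVar t) : IsAbsolute fun v => s v = t v := by
  obtain ⟨i, hi⟩ := hs
  obtain ⟨j, hj⟩ := ht
  refine ⟨Term.bdEqual (Term.var (.inr i)) (Term.var (.inr j)), fun γ _ v => ?_⟩
  rw [BoundedFormula.realize_bdEqual]
  simp only [hi, hj]
  exact Subtype.ext_iff

theorem IsAbsolute.imp {n : ℕ} {P Q : (Fin n → ZFSet.{0}) → Prop} (hP : IsAbsolute P)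
    (hQ : IsAbsolute Q) : IsAbsolute fun v => P v → Q v := by
  obtain ⟨φ, hφ⟩ := hP
  obtain ⟨ψ, hψ⟩ := hQ
  exact ⟨φ.imp ψ, fun γ hγ v => by rw [BoundedFormula.realize_imp, hφ γ hγ, hψ γ hγ]⟩

theorem IsAbsolute.not {n : ℕ} {P : (Fin n → ZFSet.{0}) → Prop} (hP : IsAbsolute P) :
    IsAbsolute fun v => ¬ P v := by
  obtain ⟨φ, hφ⟩ := hP
  exact ⟨φ.not, fun γ hγ v => by rw [BoundedFormula.realize_not, hφ γ hγ]⟩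

theorem IsAbsolute.and {n : ℕ} {P Q : (Fin n → ZFSet.{0}) → Prop} (hP : IsAbsolute P)
    (hQ : IsAbsolute Q) : IsAbsolute fun v => P v ∧ Q v :=
  (hP.imp hQ.not).not.congr fun _ => by tauto

theorem IsAbsolute.or {n : ℕ} {P Q : (Fin n → ZFSet.{0}) → Prop} (hP : IsAbsolute P)
    (hQ : IsAbsolute Q) : IsAbsolute fun v => P v ∨ Q v :=
  (hP.not.imp hQ).congr fun _ => by tauto

theorem IsAbsolute.iff {n : ℕ} {P Q : (Fin n → ZFSet.{0}) → Prop} (hP : IsAbsolute P)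
    (hQ : IsAbsolute Q) : IsAbsolute fun v => P v ↔ Q v :=
  ((hP.imp hQ).and (hQ.imp hP)).congr fun _ => by tauto

/-- Absoluteness is preserved by an existential quantifier whose witnesses lie in every `V_γ`
containing the parameters. -/
theorem IsAbsolute.exists {n : ℕ} {P : (Fin n → ZFSet.{0}) → ZFSet.{0} → Prop}
    (hP : IsAbsolute fun v : Fin (n + 1) → ZFSet => P (Fin.init v) (v (Fin.last n)))
    (h : ∀ γ : Ordinal.{0}, Order.IsSuccLimit γ → ∀ v : Fin n → Vt γ, ∀ x,
      P (fun i => v i) x → x.rank < γ) :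
    IsAbsolute fun v => ∃ x, P v x := by
  obtain ⟨φ, hφ⟩ := hP
  refine ⟨φ.ex, fun γ hγ v => ?_⟩
  rw [BoundedFormula.realize_ex]
  have key (a : Vt γ) : φ.Realize default (Fin.snoc v a) ↔ P (fun i => v i) a := by
    rw [hφ γ hγ]
    simp [Fin.init_def]
  simp only [key]
  exact ⟨fun ⟨a, ha⟩ => ⟨a, ha⟩, fun ⟨x, hx⟩ => ⟨⟨x, h γ hγ v x hx⟩, hx⟩⟩

theorem IsAbsolute.existsMem {n : ℕ} {t : (Fin n → ZFSet.{0}) → ZFSet.{0}} (ht : IsVar t)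
    {P : (Fin n → ZFSet.{0}) → ZFSet.{0} → Prop}
    (hP : IsAbsolute fun v : Fin (n + 1) → ZFSet => P (Fin.init v) (v (Fin.last n))) :
    IsAbsolute fun v => ∃ x ∈ t v, P v x :=
  .exists ((IsAbsolute.mem (.proj _) ht.init).and hP) fun _ _ v _ hx =>
    (ZFSet.rank_lt_of_mem hx.1).trans (ht.rank_lt v)

theorem IsAbsolute.forallMem {n : ℕ} {t : (Fin n → ZFSet.{0}) → ZFSet.{0}} (ht : IsVar t)
    {P : (Fin n → ZFSet.{0}) → ZFSet.{0} → Prop}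
    (hP : IsAbsolute fun v : Fin (n + 1) → ZFSet => P (Fin.init v) (v (Fin.last n))) :
    IsAbsolute fun v => ∀ x ∈ t v, P v x :=
  (IsAbsolute.existsMem (P := fun v x => ¬ P v x) ht hP.not).not.congr fun _ => by
    push Not; rfl

theorem IsAbsolute.subset {n : ℕ} {s t : (Fin n → ZFSet.{0}) → ZFSet.{0}} (hs : IsVar s)
    (ht : IsVar t) : IsAbsolute fun v => s v ⊆ t v :=
  (IsAbsolute.forallMem hs (.mem (.proj _) ht.init)).congr fun _ => ZFSet.subset_def

theorem IsAbsolute.existsSubset {n : ℕ} {t : (Fin n → ZFSet.{0}) → ZFSet.{0}} (ht : IsVar t)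
    {P : (Fin n → ZFSet.{0}) → ZFSet.{0} → Prop}
    (hP : IsAbsolute fun v : Fin (n + 1) → ZFSet => P (Fin.init v) (v (Fin.last n))) :
    IsAbsolute fun v => ∃ x ⊆ t v, P v x :=
  .exists ((IsAbsolute.subset (.proj _) ht.init).and hP) fun _ _ v _ hx =>
    (ZFSet.rank_mono hx.1).trans_lt (ht.rank_lt v)

theorem IsAbsolute.forallSubset {n : ℕ} {t : (Fin n → ZFSet.{0}) → ZFSet.{0}} (ht : IsVar t)
    {P : (Fin n → ZFSet.{0}) → ZFSet.{0} → Prop}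
    (hP : IsAbsolute fun v : Fin (n + 1) → ZFSet => P (Fin.init v) (v (Fin.last n))) :
    IsAbsolute fun v => ∀ x ⊆ t v, P v x :=
  (IsAbsolute.existsSubset (P := fun v x => ¬ P v x) ht hP.not).not.congr fun _ => by
    push Not; rfl

theorem eq_pair_iff {p x y : ZFSet.{0}} : p = x.pair y ↔
    ((∃ z ∈ p, x ∈ z ∧ ∀ u ∈ z, u = x) ∧ ∃ z ∈ p, x ∈ z ∧ y ∈ z ∧ ∀ u ∈ z, u = x ∨ u = y) ∧
      ∀ z ∈ p, (x ∈ z ∧ ∀ u ∈ z, u = x) ∨ x ∈ z ∧ y ∈ z ∧ ∀ u ∈ z, u = x ∨ u = y := by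
  have h₁ (z : ZFSet.{0}) : (x ∈ z ∧ ∀ u ∈ z, u = x) ↔ z = {x} := by
    rw [ZFSet.ext_iff]
    simp only [ZFSet.mem_singleton]
    exact ⟨fun h u => ⟨h.2 u, fun hu => hu ▸ h.1⟩, fun h => ⟨(h x).2 rfl, fun u => (h u).1⟩⟩
  have h₂ (z : ZFSet.{0}) : (x ∈ z ∧ y ∈ z ∧ ∀ u ∈ z, u = x ∨ u = y) ↔ z = {x, y} := by
    rw [ZFSet.ext_iff]
    simp only [ZFSet.mem_pair]
    refine ⟨fun h u => ⟨h.2.2 u, ?_⟩,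
      fun h => ⟨(h x).2 (.inl rfl), (h y).2 (.inr rfl), fun u => (h u).1⟩⟩
    rintro (rfl | rfl)
    exacts [h.1, h.2.1]
  simp only [h₁, h₂, exists_eq_right]
  rw [ZFSet.ext_iff]
  simp only [ZFSet.pair, ZFSet.mem_pair]
  refine ⟨fun h => ⟨⟨(h _).2 (.inl rfl), (h _).2 (.inr rfl)⟩, fun z => (h z).1⟩,
    fun h z => ⟨h.2 z, ?_⟩⟩
  rintro (rfl | rfl)
  exacts [h.1.1, h.1.2]

theorem IsAbsolute.eqPair {n : ℕ} {p s t : (Fin n → ZFSet.{0}) → ZFSet.{0}} (hp : IsVar p)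
    (hs : IsVar s) (ht : IsVar t) : IsAbsolute fun v => p v = (s v).pair (t v) := by
  have h₁ : IsAbsolute fun v : Fin (n + 1) → ZFSet =>
      s (Fin.init v) ∈ v (Fin.last n) ∧ ∀ u ∈ v (Fin.last n), u = s (Fin.init v) :=
    .and (.mem hs.init (.proj _)) (.forallMem (.proj _) (.eq (.proj _) hs.init.init))
  have h₂ : IsAbsolute fun v : Fin (n + 1) → ZFSet =>
      s (Fin.init v) ∈ v (Fin.last n) ∧ t (Fin.init v) ∈ v (Fin.last n) ∧
        ∀ u ∈ v (Fin.last n), u = s (Fin.init v) ∨ u = t (Fin.init v) :=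
    .and (.mem hs.init (.proj _)) (.and (.mem ht.init (.proj _))
      (.forallMem (.proj _) (.or (.eq (.proj _) hs.init.init) (.eq (.proj _) ht.init.init))))
  exact (((IsAbsolute.existsMem hp h₁).and (.existsMem hp h₂)).and
    (.forallMem hp (h₁.or h₂))).congr fun _ => eq_pair_iff

theorem IsAbsolute.pairMem {n : ℕ} {s t f : (Fin n → ZFSet.{0}) → ZFSet.{0}} (hs : IsVar s)
    (ht : IsVar t) (hf : IsVar f) : IsAbsolute fun v => (s v).pair (t v) ∈ f v := by
  have h : IsAbsolute fun v => ∃ p ∈ f v, p = (s v).pair (t v) :=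
    .existsMem hf (.eqPair (.proj _) hs.init ht.init)
  exact h.congr fun _ => exists_eq_right.symm

theorem mem_funs_iff {s w d : ZFSet.{0}} : s ∈ w.funs d ↔
    (∀ p ∈ s, ∃ i ∈ w, ∃ z ∈ d, p = i.pair z) ∧
      ∀ i ∈ w, ∃ z ∈ d, i.pair z ∈ s ∧ ∀ y ∈ d, i.pair y ∈ s → y = z := by
  rw [ZFSet.mem_funs, ZFSet.IsFunc, ZFSet.subset_def]
  simp only [ZFSet.mem_prod, ExistsUnique]
  refine and_congr_right fun h => forall₂_congr fun i _ => ?_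
  have hd {y : ZFSet.{0}} (hy : i.pair y ∈ s) : y ∈ d := by
    obtain ⟨j, _, z, hz, hp⟩ := h hy
    rwa [(ZFSet.pair_injective hp).2]
  exact ⟨fun ⟨z, hz, hu⟩ => ⟨z, hd hz, hz, fun y _ => hu y⟩,
    fun ⟨z, _, hz, hu⟩ => ⟨z, hz, fun y hy => hu y (hd hy) hy⟩⟩

theorem IsAbsolute.memFuns {n : ℕ} {s w d : (Fin n → ZFSet.{0}) → ZFSet.{0}} (hs : IsVar s)
    (hw : IsVar w) (hd : IsVar d) : IsAbsolute fun v => s v ∈ (w v).funs (d v) := by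
  obtain ⟨i, hi⟩ := hs
  obtain ⟨j, hj⟩ := hw
  obtain ⟨k, hk⟩ := hd
  simp only [mem_funs_iff, hi, hj, hk]
  repeat' first
    | apply IsAbsolute.eqPair
    | apply IsAbsolute.pairMem
    | apply IsAbsolute.eq
    | apply IsAbsolute.existsMem
    | apply IsAbsolute.forallMem
    | apply IsAbsolute.and
    | apply IsAbsolute.imp
    | apply IsVar.proj

/-! ### Levels of the cumulative hierarchy -/

/-- `h` is a history of levels ending just below `d`, so that `d` is itself a level. -/
def IsHistory (h d : ZFSet.{0}) : Prop :=
  ((∀ x ∈ d, ∃ y ∈ h, x ⊆ y) ∧ ∀ y ∈ h, ∀ x ⊆ y, x ∈ d) ∧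
    ∀ v ∈ h, (∀ x ∈ v, ∃ y ∈ h, y ∈ v ∧ x ⊆ y) ∧ ∀ y ∈ h, y ∈ v → ∀ x ⊆ y, x ∈ v

/-- The restriction of the relation `f` to `x × d` is functional. -/
def IsFunctionalOn (f x d : ZFSet.{0}) : Prop :=
  ∀ y ∈ x, ∀ z ∈ d, ∀ w ∈ d, y.pair z ∈ f → y.pair w ∈ f → z = w

/-- `b` is a level of limit height into which no member of `b` maps unboundedly. -/
def IsRegularLevel (b : ZFSet.{0}) : Prop :=
  (∃ h ⊆ b, IsHistory h b) ∧ (∀ x ∈ b, ∃ y ∈ b, x ∈ y) ∧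
    ∀ f ⊆ b, ∀ x ∈ b, IsFunctionalOn f x b → ∃ c ∈ b, ∀ y ∈ x, ∀ z ∈ b, y.pair z ∈ f → z ∈ c

/-- `d` is a level of limit height, and no member of `d` maps onto the levels below `d`. -/
def IsCardinalLevel (d : ZFSet.{0}) : Prop :=
  (∃ h ⊆ d, IsHistory h d ∧ ∀ f ⊆ d, ∀ x ∈ d, IsFunctionalOn f x d →
    ∃ v ∈ h, ∀ y ∈ x, y.pair v ∉ f) ∧ ∀ x ∈ d, ∃ y ∈ d, x ∈ y

/-- The assignments `s` and `t` with values in `d` agree at all indices in `w` except `i`. -/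
def AgreeOff (w d i s t : ZFSet.{0}) : Prop :=
  ∀ j ∈ w, j ≠ i → ∀ z ∈ d, j.pair z ∈ s → j.pair z ∈ t

/-- `D` is a family of sets of assignments `w → d`, containing the sets defined by the atomic
formulas and closed under the operations corresponding to the connectives and quantifiers. -/
def IsLogicallyClosed (w d D : ZFSet.{0}) : Prop :=
  (∀ i ∈ w, ∀ j ∈ w, ∃ B ∈ D, ∀ s ⊆ d, s ∈ w.funs d →
    (s ∈ B ↔ ∃ x ∈ d, ∃ y ∈ d, i.pair x ∈ s ∧ j.pair y ∈ s ∧ x ∈ y)) ∧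
  (∀ i ∈ w, ∀ j ∈ w, ∃ B ∈ D, ∀ s ⊆ d, s ∈ w.funs d →
    (s ∈ B ↔ ∃ x ∈ d, i.pair x ∈ s ∧ j.pair x ∈ s)) ∧
  (∃ B ∈ D, ∀ s ⊆ d, s ∈ w.funs d → s ∉ B) ∧
  (∀ B ∈ D, ∀ C ∈ D, ∃ E ∈ D, ∀ s ⊆ d, s ∈ w.funs d → (s ∈ E ↔ (s ∈ B → s ∈ C))) ∧
  ∀ B ∈ D, ∀ i ∈ w, ∃ C ∈ D, ∀ s ⊆ d, s ∈ w.funs d →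
    (s ∈ C ↔ ∀ s' ⊆ d, s' ∈ w.funs d → AgreeOff w d i s s' → s' ∈ B)

/-- The Tarski–Vaught test for `b` inside `d`, with respect to the family `D`. -/
def TarskiVaught (w b d D : ZFSet.{0}) : Prop :=
  ∀ B ∈ D, ∀ i ∈ w, ∀ s ⊆ d, s ∈ w.funs d → s ∈ B →
    (∀ j ∈ w, j ≠ i → ∀ z ∈ d, j.pair z ∈ s → z ∈ b) →
    ∃ s' ⊆ d, s' ∈ w.funs d ∧ s' ∈ B ∧ AgreeOff w d i s s' ∧ ∀ z ∈ d, i.pair z ∈ s' → z ∈ b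

/-- `b` is an elementary substructure of `d`, expressed in the language of set theory. -/
def IsElemSub (w b d : ZFSet.{0}) : Prop :=
  ∃ D, D ⊆ d.powerset.powerset ∧ IsLogicallyClosed w d D ∧ TarskiVaught w b d D

theorem rank_powerset_lt {x : ZFSet.{0}} {γ : Ordinal.{0}} (hγ : Order.IsSuccLimit γ)
    (hx : x.rank < γ) : x.powerset.rank < γ := by
  rw [ZFSet.rank_powerset]
  exact hγ.succ_lt hx

theorem IsAbsolute.isRegularLevel {n : ℕ} {b : (Fin n → ZFSet.{0}) → ZFSet.{0}} (hb : IsVar b) :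
    IsAbsolute fun v => IsRegularLevel (b v) := by
  obtain ⟨i, hi⟩ := hb
  simp only [hi]
  unfold IsRegularLevel IsHistory IsFunctionalOn
  repeat' first
    | apply IsAbsolute.pairMem
    | apply IsAbsolute.mem
    | apply IsAbsolute.eq
    | apply IsAbsolute.subset
    | apply IsAbsolute.existsMem
    | apply IsAbsolute.existsSubset
    | apply IsAbsolute.forallMem
    | apply IsAbsolute.forallSubset
    | apply IsAbsolute.and
    | apply IsAbsolute.imp
    | apply IsVar.proj

theorem IsAbsolute.isCardinalLevel {n : ℕ} {d : (Fin n → ZFSet.{0}) → ZFSet.{0}} (hd : IsVar d) :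
    IsAbsolute fun v => IsCardinalLevel (d v) := by
  obtain ⟨i, hi⟩ := hd
  simp only [hi]
  unfold IsCardinalLevel IsHistory IsFunctionalOn
  repeat' first
    | apply IsAbsolute.pairMem
    | apply IsAbsolute.mem
    | apply IsAbsolute.eq
    | apply IsAbsolute.subset
    | apply IsAbsolute.existsMem
    | apply IsAbsolute.existsSubset
    | apply IsAbsolute.forallMem
    | apply IsAbsolute.forallSubset
    | apply IsAbsolute.and
    | apply IsAbsolute.not
    | apply IsAbsolute.imp
    | apply IsVar.proj

theorem IsAbsolute.isElemSub {n : ℕ} {w b d : (Fin n → ZFSet.{0}) → ZFSet.{0}} (hw : IsVar w)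
    (hb : IsVar b) (hd : IsVar d) : IsAbsolute fun v => IsElemSub (w v) (b v) (d v) := by
  refine .exists ?_ fun γ hγ v x hx => (ZFSet.rank_mono hx.1).trans_lt
    (rank_powerset_lt hγ (rank_powerset_lt hγ (hd.rank_lt v)))
  obtain ⟨i, hi⟩ := hw
  obtain ⟨j, hj⟩ := hb
  obtain ⟨k, hk⟩ := hd
  simp only [hi, hj, hk, ZFSet.subset_def (y := ZFSet.powerset _), ZFSet.mem_powerset]
  unfold IsLogicallyClosed TarskiVaught AgreeOff
  repeat' first
    | apply IsAbsolute.pairMem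
    | apply IsAbsolute.memFuns
    | apply IsAbsolute.mem
    | apply IsAbsolute.eq
    | apply IsAbsolute.subset
    | apply IsAbsolute.existsMem
    | apply IsAbsolute.existsSubset
    | apply IsAbsolute.forallMem
    | apply IsAbsolute.forallSubset
    | apply IsAbsolute.and
    | apply IsAbsolute.not
    | apply IsAbsolute.iff
    | apply IsAbsolute.imp
    | apply IsVar.proj

open scoped ZFSet

theorem rank_pair_lt {x y : ZFSet.{0}} {γ : Ordinal.{0}} (hγ : Order.IsSuccLimit γ)
    (hx : x.rank < γ) (hy : y.rank < γ) : (x.pair y).rank < γ := by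
  simp only [ZFSet.pair, ZFSet.rank_pair, ZFSet.rank_singleton, max_lt_iff]
  exact ⟨hγ.succ_lt (hγ.succ_lt hx), hγ.succ_lt (max_lt (hγ.succ_lt hx) (hγ.succ_lt hy))⟩

theorem eq_vonNeumann_rank {d : ZFSet.{0}} {S : ZFSet.{0} → Prop}
    (hS : ∀ y, S y → y = V_ y.rank) (h₁ : ∀ x ∈ d, ∃ y, S y ∧ x ⊆ y)
    (h₂ : ∀ y, S y → ∀ x ⊆ y, x ∈ d) : d = V_ d.rank := by
  ext x
  rw [ZFSet.mem_vonNeumann]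
  refine ⟨ZFSet.rank_lt_of_mem, fun hx => ?_⟩
  obtain ⟨y, hy, hxy⟩ := ZFSet.lt_rank_iff.1 hx
  obtain ⟨z, hz, hyz⟩ := h₁ y hy
  refine h₂ z hz x ?_
  rw [hS z hz, ZFSet.subset_vonNeumann]
  exact hxy.trans (ZFSet.rank_mono hyz)

theorem IsHistory.eq_vonNeumann_of_mem {h d : ZFSet.{0}} (H : IsHistory h d) (v : ZFSet.{0}) :
    v ∈ h → v = V_ v.rank := by
  induction v using ZFSet.inductionOn with
  | _ v ih =>
    intro hv
    refine eq_vonNeumann_rank (S := fun y => y ∈ h ∧ y ∈ v) (fun y hy => ih y hy.2 hy.1) ?_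
      fun y hy => (H.2 v hv).2 y hy.1 hy.2
    intro x hx
    obtain ⟨y, hy, hyv, hxy⟩ := (H.2 v hv).1 x hx
    exact ⟨y, ⟨hy, hyv⟩, hxy⟩

theorem IsHistory.eq_vonNeumann {h d : ZFSet.{0}} (H : IsHistory h d) : d = V_ d.rank :=
  eq_vonNeumann_rank (S := (· ∈ h)) H.eq_vonNeumann_of_mem H.1.1 H.1.2

theorem isHistory_range (δ : Ordinal.{0}) :
    IsHistory (ZFSet.range fun a : Set.Iio δ => V_ a.1) (V_ δ) := by
  simp only [IsHistory, ZFSet.mem_range, Subtype.exists, Set.mem_Iio, exists_prop,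
    forall_exists_index, and_imp, forall_apply_eq_imp_iff₂, ZFSet.mem_vonNeumann']
  refine ⟨⟨?_, ?_⟩, fun a ha => ⟨?_, ?_⟩⟩
  · exact fun x a ha hx => ⟨_, ⟨a, ha, rfl⟩, hx⟩
  · exact fun a ha x hx => ⟨a, ha, hx⟩
  · exact fun x c hc hx => ⟨_, ⟨c, hc.trans ha, rfl⟩, ⟨c, hc, subset_rfl⟩, hx⟩
  · exact fun c _ e he hce x hx => ⟨e, he, hx.trans hce⟩

theorem range_vonNeumann_subset (δ : Ordinal.{0}) :
    (ZFSet.range fun a : Set.Iio δ => V_ a.1) ⊆ V_ δ := by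
  rw [ZFSet.subset_def]
  simp [ZFSet.mem_vonNeumann]

theorem isSuccLimit_of_forall_mem {δ η : Ordinal.{0}} (hη : η < δ)
    (h : ∀ x ∈ V_ δ, ∃ y ∈ V_ δ, x ∈ y) : Order.IsSuccLimit δ := by
  rw [Ordinal.isSuccLimit_iff, Order.isSuccPrelimit_iff_succ_lt]
  refine ⟨hη.ne_bot, fun a ha => ?_⟩
  obtain ⟨y, hy, hay⟩ := h (V_ a) (ZFSet.vonNeumann_mem_of_lt ha)
  have := ZFSet.rank_lt_of_mem hay
  rw [ZFSet.rank_vonNeumann] at this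
  exact (Order.succ_le_of_lt this).trans_lt (ZFSet.mem_vonNeumann.1 hy)

theorem exists_mem_vonNeumann_of_isSuccLimit {δ : Ordinal.{0}} (hδ : Order.IsSuccLimit δ) :
    ∀ x ∈ V_ δ, ∃ y ∈ V_ δ, x ∈ y := fun x hx =>
  ⟨{x}, ZFSet.mem_vonNeumann.2 (by
    rw [ZFSet.rank_singleton]; exact hδ.succ_lt (ZFSet.mem_vonNeumann.1 hx)), by simp⟩

theorem IsRegularLevel.eq_vonNeumann {b : ZFSet.{0}} (hb : IsRegularLevel b) : b = V_ b.rank :=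
  hb.1.choose_spec.2.eq_vonNeumann

theorem IsRegularLevel.exists_bound {β : Ordinal.{0}} (hb : IsRegularLevel (V_ β))
    {x : ZFSet.{0}} (hx : x.rank < β) (F : x → Ordinal.{0}) (hF : ∀ y, F y < β) :
    ∃ α < β, ∀ y, F y < α := by
  have hβ := isSuccLimit_of_forall_mem hx hb.2.1
  have hf : (ZFSet.range fun y : x => ZFSet.pair y (V_ (F y))) ⊆ V_ β := by
    rw [ZFSet.subset_def]
    intro p hp
    obtain ⟨y, rfl⟩ := ZFSet.mem_range.1 hp
    rw [ZFSet.mem_vonNeumann]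
    exact rank_pair_lt hβ ((ZFSet.rank_lt_of_mem y.2).trans hx) (by simpa using hF y)
  obtain ⟨c, hc, hcf⟩ := hb.2.2 _ hf x (ZFSet.mem_vonNeumann.2 hx) (by
    intro y hy z _ z' _ h h'
    obtain ⟨u, hu⟩ := ZFSet.mem_range.1 h
    obtain ⟨u', hu'⟩ := ZFSet.mem_range.1 h'
    obtain ⟨h₁, h₂⟩ := ZFSet.pair_injective hu
    obtain ⟨h₁', h₂'⟩ := ZFSet.pair_injective hu'
    have : u = u' := Subtype.ext (h₁.trans h₁'.symm)
    rw [← h₂, ← h₂', this])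
  refine ⟨c.rank, ZFSet.mem_vonNeumann.1 hc, fun y => ?_⟩
  have := ZFSet.rank_lt_of_mem (hcf y y.2 (V_ (F y)) (ZFSet.vonNeumann_mem_of_lt (hF y))
    (ZFSet.mem_range_self y))
  rwa [ZFSet.rank_vonNeumann] at this

theorem IsRegularLevel.card_lt_cof {β : Ordinal.{0}} (hb : IsRegularLevel (V_ β))
    {x : ZFSet.{0}} (hx : x.rank < β) : x.card < β.cof := by
  by_contra! h
  rw [← Ordinal.cof_toType] at h
  obtain ⟨S, hS, hSc⟩ := Order.exists_cof_eq β.ToType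
  rw [← hSc, ZFSet.card, Cardinal.le_def] at h
  obtain ⟨e⟩ := h
  have hβ : β ≠ 0 := hx.ne_bot
  have : Nonempty β.ToType := Ordinal.nonempty_toType_iff.2 hβ
  have : Nonempty S := hS.nonempty.to_subtype
  let F (y : x) : Ordinal.{0} :=
    (Ordinal.ToType.mk.symm (Function.invFun e (equivShrink x y)).1 : Set.Iio β)
  obtain ⟨α, hα, hF⟩ := hb.exists_bound hx F fun y => (Ordinal.ToType.mk.symm _).2
  obtain ⟨s, hs, hle⟩ := hS (Ordinal.ToType.mk ⟨α, hα⟩)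
  have h₁ := hF ((equivShrink x).symm (e ⟨s, hs⟩))
  simp only [F, Equiv.apply_symm_apply, Function.leftInverse_invFun e.injective _] at h₁
  have h₂ := (OrderIso.le_symm_apply _).2 hle
  exact h₁.not_ge h₂

theorem IsRegularLevel.isInaccOrd {β : Ordinal.{0}} (hb : IsRegularLevel (V_ β))
    (hω : Ordinal.omega0 < β) : IsInaccOrd β := by
  have hβ := isSuccLimit_of_forall_mem hω hb.2.1
  have hlt {x : ZFSet.{0}} (hx : x.rank < β) : x.card < β.card :=
    (hb.card_lt_cof hx).trans_le (Ordinal.cof_le_card β)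
  have hord : β.card.ord = β := by
    refine (Cardinal.ord_card_le β).antisymm (le_of_not_gt fun h => ?_)
    simpa using hlt (x := β.card.ord.toZFSet) (by simpa using h)
  refine ⟨⟨?_, ?_, ?_⟩, hord⟩
  · simpa using hlt (x := Ordinal.omega0.toZFSet) (by simpa using hω)
  · rw [hord]
    by_contra! h
    have := hb.card_lt_cof (x := β.cof.ord.toZFSet) (by
      rw [Ordinal.rank_toZFSet]
      exact (Cardinal.ord_lt_ord.2 h).trans_eq hord)
    simp at this
  · intro c hc
    have := hlt (x := (c.ord.toZFSet).powerset) (rank_powerset_lt hβ (by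
      rw [Ordinal.rank_toZFSet]
      exact (Cardinal.ord_lt_ord.2 hc).trans_eq hord))
    simpa using this

theorem IsInaccOrd.isSuccLimit {γ : Ordinal.{0}} (hγ : IsInaccOrd γ) : Order.IsSuccLimit γ := by
  rw [← hγ.2]
  exact Cardinal.isSuccLimit_ord hγ.1.aleph0_lt.le

theorem IsInaccOrd.omega0_lt {γ : Ordinal.{0}} (hγ : IsInaccOrd γ) : Ordinal.omega0 < γ := by
  rw [← hγ.2]
  exact Cardinal.omega0_lt_ord.2 hγ.1.aleph0_lt

theorem IsInaccOrd.card_le_cof {γ : Ordinal.{0}} (hγ : IsInaccOrd γ) : γ.card ≤ γ.cof := by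
  simpa [hγ.2] using hγ.1.le_cof_ord

theorem IsInaccOrd.card_lt {γ : Ordinal.{0}} (hγ : IsInaccOrd γ) {x : ZFSet.{0}}
    (hx : x.rank < γ) : x.card < γ.card := by
  refine (ZFSet.card_mono (ZFSet.subset_vonNeumann_self x)).trans_lt ?_
  rw [ZFSet.card_vonNeumann, ← hγ.1.preBeth_ord, hγ.2]
  exact Cardinal.preBeth_strictMono hx

theorem IsInaccOrd.isRegularLevel {κ : Ordinal.{0}} (hκ : IsInaccOrd κ) :
    IsRegularLevel (V_ κ) := by
  refine ⟨⟨_, range_vonNeumann_subset κ, isHistory_range κ⟩,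
    exists_mem_vonNeumann_of_isSuccLimit hκ.isSuccLimit, fun f _ x hx hfun => ?_⟩
  classical
  let F (y : Shrink.{0} x) : Ordinal.{0} :=
    if h : ∃ z ∈ V_ κ, ZFSet.pair ((equivShrink x).symm y) z ∈ f then h.choose.rank else 0
  have hF (y) : F y < κ := by
    by_cases h : ∃ z ∈ V_ κ, ZFSet.pair ((equivShrink x).symm y) z ∈ f
    · simpa [F, dif_pos h] using ZFSet.mem_vonNeumann.1 h.choose_spec.1
    · simpa [F, dif_neg h] using hκ.isSuccLimit.bot_lt
  have hsup := Ordinal.iSup_add_one_lt_of_lt_cof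
    ((hκ.card_lt (ZFSet.mem_vonNeumann.1 hx)).trans_le hκ.card_le_cof) hF
  refine ⟨_, ZFSet.vonNeumann_mem_of_lt hsup, fun y hy z hz hyz => ?_⟩
  have h : ∃ z ∈ V_ κ,
      ZFSet.pair ((equivShrink x).symm (equivShrink x ⟨y, hy⟩)) z ∈ f := ⟨z, hz, by simpa⟩
  have hzF : z.rank = F (equivShrink x ⟨y, hy⟩) := by
    simp only [F, dif_pos h]
    congr 1
    exact hfun y hy z hz _ h.choose_spec.1 hyz (by simpa using h.choose_spec.2)
  rw [ZFSet.mem_vonNeumann, hzF]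
  exact (lt_add_one _).trans_le (Ordinal.le_iSup (fun y => F y + 1) _)

theorem IsCardinalLevel.eq_vonNeumann {d : ZFSet.{0}} (hd : IsCardinalLevel d) :
    d = V_ d.rank :=
  hd.1.choose_spec.2.1.eq_vonNeumann

theorem IsCardinalLevel.isCardOrd {δ η : Ordinal.{0}} (hd : IsCardinalLevel (V_ δ))
    (hη : η < δ) : IsCardOrd δ := by
  have hδ := isSuccLimit_of_forall_mem hη hd.2
  refine (Cardinal.ord_card_le δ).antisymm (le_of_not_gt fun hμ => ?_)
  obtain ⟨h, -, hh, H⟩ := hd.1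
  obtain ⟨e⟩ : Nonempty (Set.Iio δ.card.ord ≃ Set.Iio δ) := by
    rw [← Cardinal.eq, Cardinal.mk_Iio_ordinal, Cardinal.mk_Iio_ordinal, Cardinal.card_ord]
  have hf : (ZFSet.range fun i : Set.Iio δ.card.ord => ZFSet.pair i.1.toZFSet (V_ (e i).1)) ⊆
      V_ δ := by
    rw [ZFSet.subset_def]
    intro p hp
    obtain ⟨i, rfl⟩ := ZFSet.mem_range.1 hp
    rw [ZFSet.mem_vonNeumann]
    exact rank_pair_lt hδ (by simpa using i.2.trans hμ) (by
      rw [ZFSet.rank_vonNeumann]; exact (e i).2)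
  obtain ⟨v, hv, hvf⟩ := H _ hf δ.card.ord.toZFSet (by simpa [ZFSet.mem_vonNeumann] using hμ) (by
    intro y hy z _ z' _ h h'
    obtain ⟨u, hu⟩ := ZFSet.mem_range.1 h
    obtain ⟨u', hu'⟩ := ZFSet.mem_range.1 h'
    obtain ⟨h₁, h₂⟩ := ZFSet.pair_injective hu
    obtain ⟨h₁', h₂'⟩ := ZFSet.pair_injective hu'
    have : u = u' := Subtype.ext (Ordinal.toZFSet_injective (h₁.trans h₁'.symm))
    rw [← h₂, ← h₂', this])
  have hvδ : v.rank < δ := ZFSet.mem_vonNeumann.1 (hh.1.2 v hv v subset_rfl)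
  let i := e.symm ⟨v.rank, hvδ⟩
  refine hvf i.1.toZFSet (Ordinal.toZFSet_mem_toZFSet_iff.2 i.2) (ZFSet.mem_range.2 ⟨i, ?_⟩)
  simp only [i, Equiv.apply_symm_apply]
  rw [← hh.eq_vonNeumann_of_mem v hv]

theorem isCardinalLevel_vonNeumann {δ : Ordinal.{0}} (hδ : Order.IsSuccLimit δ)
    (h : ∀ x : ZFSet.{0}, x.rank < δ → x.card < δ.card) : IsCardinalLevel (V_ δ) := by
  refine ⟨⟨_, range_vonNeumann_subset δ, isHistory_range δ, fun f _ x hx hfun => ?_⟩,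
    exists_mem_vonNeumann_of_isSuccLimit hδ⟩
  by_contra! H
  choose g hg hgf using fun a : Set.Iio δ => H (V_ a.1) (ZFSet.mem_range_self a)
  have hinj : Function.Injective fun a : Set.Iio δ => (⟨g a, hg a⟩ : x) := by
    intro a a' haa
    have haa : g a = g a' := congrArg Subtype.val haa
    exact Subtype.ext (ZFSet.vonNeumann_injective (hfun _ (hg a) _
      (ZFSet.vonNeumann_mem_of_lt a.2) _ (ZFSet.vonNeumann_mem_of_lt a'.2) (hgf a)
      (haa ▸ hgf a')))
  have hle := Cardinal.mk_le_of_injective hinj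
  rw [Cardinal.mk_Iio_ordinal, ZFSet.cardinalMk_coe_sort, Cardinal.lift_le] at hle
  exact hle.not_gt (h x (ZFSet.mem_vonNeumann.1 hx))

/-! ### Assignments coded as sets -/

/-- The natural number `n` as a von Neumann ordinal. -/
noncomputable def numeral (n : ℕ) : ZFSet.{0} := (n : Ordinal.{0}).toZFSet

theorem numeral_injective : Function.Injective numeral := fun m n h => by
  exact_mod_cast Ordinal.toZFSet_injective h

theorem mem_omega0_toZFSet {i : ZFSet.{0}} :
    i ∈ Ordinal.omega0.toZFSet ↔ ∃ n, i = numeral n := by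
  rw [Ordinal.mem_toZFSet_iff]
  constructor
  · rintro ⟨a, ha, rfl⟩
    obtain ⟨n, rfl⟩ := Ordinal.lt_omega0.1 ha
    exact ⟨n, rfl⟩
  · rintro ⟨n, rfl⟩
    exact ⟨n, Ordinal.natCast_lt_omega0 n, rfl⟩

/-- The assignment `s : ℕ → V_δ` as a set of ordered pairs. -/
noncomputable def code {δ : Ordinal.{0}} (s : ℕ → Vt δ) : ZFSet.{0} :=
  ZFSet.range fun n : ℕ => (numeral n).pair (s n)

theorem pair_mem_code {δ : Ordinal.{0}} {s : ℕ → Vt δ} {n : ℕ} {z : ZFSet.{0}} :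
    (numeral n).pair z ∈ code s ↔ z = s n := by
  rw [code, ZFSet.mem_range]
  constructor
  · rintro ⟨m, hm⟩
    obtain ⟨h₁, h₂⟩ := ZFSet.pair_injective hm
    rw [← h₂, numeral_injective h₁]
  · rintro rfl
    exact ⟨n, rfl⟩

theorem code_injective {δ : Ordinal.{0}} : Function.Injective (code (δ := δ)) := fun _ _ h =>
  funext fun _ => Subtype.ext (pair_mem_code.1 (h ▸ pair_mem_code.2 rfl))

theorem code_subset {δ : Ordinal.{0}} (hδ : Order.IsSuccLimit δ) (s : ℕ → Vt δ) :
    code s ⊆ V_ δ := by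
  rw [ZFSet.subset_def]
  intro p hp
  obtain ⟨n, rfl⟩ := ZFSet.mem_range.1 hp
  rw [ZFSet.mem_vonNeumann]
  refine rank_pair_lt hδ ?_ (s n).2
  rw [numeral, Ordinal.rank_toZFSet]
  exact hδ.natCast_lt n

theorem code_mem_funs {δ : Ordinal.{0}} (s : ℕ → Vt δ) :
    code s ∈ Ordinal.omega0.toZFSet.funs (V_ δ) := by
  rw [mem_funs_iff]
  constructor
  · intro p hp
    obtain ⟨n, rfl⟩ := ZFSet.mem_range.1 hp
    exact ⟨_, mem_omega0_toZFSet.2 ⟨n, rfl⟩, _, ZFSet.mem_vonNeumann.2 (s n).2, rfl⟩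
  · intro i hi
    obtain ⟨n, rfl⟩ := mem_omega0_toZFSet.1 hi
    exact ⟨_, ZFSet.mem_vonNeumann.2 (s n).2, pair_mem_code.2 rfl,
      fun y _ hy => pair_mem_code.1 hy⟩

theorem exists_eq_code {δ : Ordinal.{0}} {f : ZFSet.{0}}
    (hf : f ∈ Ordinal.omega0.toZFSet.funs (V_ δ)) : ∃ s : ℕ → Vt δ, f = code s := by
  obtain ⟨h₁, h₂⟩ := mem_funs_iff.1 hf
  choose g hg hgf hgu using fun n => h₂ (numeral n) (mem_omega0_toZFSet.2 ⟨n, rfl⟩)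
  refine ⟨fun n => ⟨g n, ZFSet.mem_vonNeumann.1 (hg n)⟩, ?_⟩
  ext p
  constructor
  · intro hp
    obtain ⟨i, hi, z, hz, rfl⟩ := h₁ p hp
    obtain ⟨n, rfl⟩ := mem_omega0_toZFSet.1 hi
    exact pair_mem_code.2 (hgu n z hz hp)
  · intro hp
    obtain ⟨n, rfl⟩ := ZFSet.mem_range.1 hp
    exact hgf n

theorem forall_funs_iff {δ : Ordinal.{0}} (hδ : Order.IsSuccLimit δ) {P : ZFSet.{0} → Prop} :
    (∀ s ⊆ V_ δ, s ∈ Ordinal.omega0.toZFSet.funs (V_ δ) → P s) ↔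
      ∀ s : ℕ → Vt δ, P (code s) := by
  refine ⟨fun h s => h _ (code_subset hδ s) (code_mem_funs s), fun h s _ hs => ?_⟩
  obtain ⟨s, rfl⟩ := exists_eq_code hs
  exact h s

theorem exists_funs_iff {δ : Ordinal.{0}} (hδ : Order.IsSuccLimit δ) {P : ZFSet.{0} → Prop} :
    (∃ s ⊆ V_ δ, s ∈ Ordinal.omega0.toZFSet.funs (V_ δ) ∧ P s) ↔
      ∃ s : ℕ → Vt δ, P (code s) := by
  refine ⟨?_, fun ⟨s, hs⟩ => ⟨_, code_subset hδ s, code_mem_funs s, hs⟩⟩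
  rintro ⟨s, _, hs, h⟩
  obtain ⟨s, rfl⟩ := exists_eq_code hs
  exact ⟨s, h⟩

theorem forall_omega0_iff {P : ZFSet.{0} → Prop} :
    (∀ i ∈ Ordinal.omega0.toZFSet, P i) ↔ ∀ n, P (numeral n) := by
  simp [mem_omega0_toZFSet]

theorem exists_vonNeumann_and_eq_iff {δ : Ordinal.{0}} {x : Vt δ} {P : ZFSet.{0} → Prop} :
    (∃ z ∈ V_ δ, z = x ∧ P z) ↔ P x :=
  ⟨by rintro ⟨_, _, rfl, h⟩; exact h, fun h => ⟨x, ZFSet.mem_vonNeumann.2 x.2, rfl, h⟩⟩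

theorem forall_vonNeumann_eq_iff {δ : Ordinal.{0}} {x : Vt δ} {P : ZFSet.{0} → Prop} :
    (∀ z ∈ V_ δ, z = x → P z) ↔ P x :=
  ⟨fun h => h x (ZFSet.mem_vonNeumann.2 x.2) rfl, by rintro h _ _ rfl; exact h⟩

theorem agreeOff_code_iff {δ : Ordinal.{0}} {n : ℕ} {s s' : ℕ → Vt δ} :
    AgreeOff Ordinal.omega0.toZFSet (V_ δ) (numeral n) (code s) (code s') ↔
      s' = Function.update s n (s' n) := by
  simp only [AgreeOff, forall_omega0_iff, pair_mem_code, forall_vonNeumann_eq_iff,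
    numeral_injective.ne_iff, Function.eq_update_iff, true_and]
  exact forall₂_congr fun j _ => by rw [← Subtype.ext_iff, eq_comm]

theorem isLogicallyClosed_iff {δ : Ordinal.{0}} (hδ : Order.IsSuccLimit δ) {D : ZFSet.{0}} :
    IsLogicallyClosed Ordinal.omega0.toZFSet (V_ δ) D ↔
      (∀ i j : ℕ, ∃ B ∈ D, ∀ s : ℕ → Vt δ, code s ∈ B ↔ (s i : ZFSet) ∈ (s j : ZFSet)) ∧
      (∀ i j : ℕ, ∃ B ∈ D, ∀ s : ℕ → Vt δ, code s ∈ B ↔ s i = s j) ∧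
      (∃ B ∈ D, ∀ s : ℕ → Vt δ, code s ∉ B) ∧
      (∀ B ∈ D, ∀ C ∈ D, ∃ E ∈ D, ∀ s : ℕ → Vt δ,
        code s ∈ E ↔ (code s ∈ B → code s ∈ C)) ∧
      ∀ B ∈ D, ∀ i : ℕ, ∃ C ∈ D, ∀ s : ℕ → Vt δ,
        code s ∈ C ↔ ∀ a, code (Function.update s i a) ∈ B := by
  have key (s : ℕ → Vt δ) (i : ℕ) (B : ZFSet.{0}) :
      (∀ s' : ℕ → Vt δ, s' = Function.update s i (s' i) → code s' ∈ B) ↔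
        ∀ a, code (Function.update s i a) ∈ B :=
    ⟨fun h a => h _ (by simp), fun h s' hs' => hs' ▸ h (s' i)⟩
  have key' (x y : Vt δ) : (∃ u ∈ V_ δ, ∃ v ∈ V_ δ, u = x ∧ v = y ∧ u ∈ v) ↔
      (x : ZFSet) ∈ (y : ZFSet) := by
    refine ⟨?_, fun h => ⟨x, ZFSet.mem_vonNeumann.2 x.2, y, ZFSet.mem_vonNeumann.2 y.2, rfl, rfl, h⟩⟩
    rintro ⟨_, _, _, _, rfl, rfl, h⟩
    exact h
  simp only [IsLogicallyClosed, forall_funs_iff hδ, forall_omega0_iff, pair_mem_code,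
    agreeOff_code_iff, key, key', exists_vonNeumann_and_eq_iff, ← Subtype.ext_iff]

theorem tarskiVaught_iff {β δ : Ordinal.{0}} (hδ : Order.IsSuccLimit δ) {D : ZFSet.{0}} :
    TarskiVaught Ordinal.omega0.toZFSet (V_ β) (V_ δ) D ↔
      ∀ B ∈ D, ∀ (i : ℕ) (s : ℕ → Vt δ), code s ∈ B →
        (∀ j, j ≠ i → (s j : ZFSet).rank < β) →
        ∃ a : Vt δ, (a : ZFSet).rank < β ∧ code (Function.update s i a) ∈ B := by
  have key (s : ℕ → Vt δ) (i : ℕ) (B : ZFSet.{0}) :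
      (∃ s' : ℕ → Vt δ, code s' ∈ B ∧ s' = Function.update s i (s' i) ∧
        (s' i : ZFSet).rank < β) ↔
        ∃ a : Vt δ, (a : ZFSet).rank < β ∧ code (Function.update s i a) ∈ B :=
    ⟨fun ⟨s', h₁, h₂, h₃⟩ => ⟨s' i, h₃, h₂ ▸ h₁⟩, fun ⟨a, h₁, h₂⟩ => ⟨_, h₂, by simpa⟩⟩
  simp only [TarskiVaught, forall_funs_iff hδ, exists_funs_iff hδ, forall_omega0_iff,
    pair_mem_code, agreeOff_code_iff, forall_vonNeumann_eq_iff, numeral_injective.ne_iff]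
  simp only [ZFSet.mem_vonNeumann, key]

/-! ### Elementarity between levels -/

/-- The inclusion of `V_β` into `V_δ`. -/
def inclusion {β δ : Ordinal.{0}} (h : β ≤ δ) : Vt β ↪[LSet] Vt δ where
  toFun x := ⟨x, x.2.trans_le h⟩
  inj' _ _ hxy := Subtype.ext (congrArg (fun x : Vt δ => (x : ZFSet)) hxy)
  map_fun' f := f.elim
  map_rel' r _ := by cases r; rfl

/-- The Tarski–Vaught test for levels of the cumulative hierarchy. -/
theorem velem_of_exists {β δ : Ordinal.{0}} (h : β ≤ δ)
    (htv : ∀ (n : ℕ) (φ : LSet.BoundedFormula Empty (n + 1)) (x : Fin n → Vt δ),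
      (∀ i, (x i : ZFSet).rank < β) → ∀ a, φ.Realize default (Fin.snoc x a : _ → Vt δ) →
        ∃ b : Vt δ, (b : ZFSet).rank < β ∧ φ.Realize default (Fin.snoc x b : _ → Vt δ)) :
    VElem β δ := by
  refine ⟨(inclusion h).toElementaryEmbedding fun n φ x a ha => ?_, fun x => rfl⟩
  obtain ⟨b, hb, hφ⟩ := htv n φ _ (fun i => (x i).2) a ha
  exact ⟨⟨b, hb⟩, hφ⟩

theorem VElem.realize_iff {β δ : Ordinal.{0}} (h : VElem β δ) (hβδ : β ≤ δ) {α : Type*} {n : ℕ}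
    (φ : LSet.BoundedFormula α n) (v : α → Vt β) (x : Fin n → Vt β) :
    φ.Realize (inclusion hβδ ∘ v) (inclusion hβδ ∘ x) ↔ φ.Realize v x := by
  obtain ⟨e, he⟩ := h
  have : (inclusion hβδ : Vt β → Vt δ) = e := funext fun x => Subtype.ext (he x).symm
  rw [this]
  exact e.map_boundedFormula φ v x

theorem VElem.of_velem_of_le {κ δ γ : Ordinal.{0}} (hκ : VElem κ γ) (hδ : VElem δ γ)
    (hκδ : κ ≤ δ) (hδγ : δ ≤ γ) : VElem κ δ := by
  refine ⟨⟨inclusion hκδ, fun n φ x => ?_⟩, fun x => rfl⟩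
  rw [Formula.Realize, Formula.Realize, ← hκ.realize_iff (hκδ.trans hδγ),
    ← hδ.realize_iff hδγ]
  exact iff_of_eq (congrArg₂ _ rfl (Subsingleton.elim _ _))

theorem term_eq_var {α : Type*} (t : LSet.Term α) : ∃ a, t = .var a := by
  cases t with
  | var a => exact ⟨a, rfl⟩
  | func f => exact f.elim

theorem bounded_term_eq_var {n : ℕ} (t : LSet.Term (Empty ⊕ Fin n)) :
    ∃ i, t = .var (.inr i) := by
  obtain ⟨a | i, rfl⟩ := term_eq_var t
  exacts [a.elim, ⟨i, rfl⟩]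

theorem snoc_eq_update {M : Type*} {n : ℕ} (s : ℕ → M) (a : M) :
    (Fin.snoc (fun i : Fin n => s i) a : Fin (n + 1) → M) =
      fun i : Fin (n + 1) => Function.update s n a i := by
  ext i
  refine Fin.lastCases ?_ (fun j => ?_) i
  · simp
  · simp [j.2.ne]

theorem IsLogicallyClosed.exists_mem {δ : Ordinal.{0}} (hδ : Order.IsSuccLimit δ) {D : ZFSet.{0}}
    (hD : IsLogicallyClosed Ordinal.omega0.toZFSet (V_ δ) D) {n : ℕ}
    (φ : LSet.BoundedFormula Empty n) :
    ∃ B ∈ D, ∀ s : ℕ → Vt δ, code s ∈ B ↔ φ.Realize default fun i : Fin n => s i := by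
  obtain ⟨hmem, heq, hbot, himp, hall⟩ := (isLogicallyClosed_iff hδ).1 hD
  induction φ with
  | falsum =>
    obtain ⟨B, hB, h⟩ := hbot
    exact ⟨B, hB, fun s => iff_of_false (h s) id⟩
  | equal t₁ t₂ =>
    obtain ⟨i, rfl⟩ := bounded_term_eq_var t₁
    obtain ⟨j, rfl⟩ := bounded_term_eq_var t₂
    exact heq i j
  | rel R ts =>
    cases R
    obtain ⟨i, hi⟩ := bounded_term_eq_var (ts 0)
    obtain ⟨j, hj⟩ := bounded_term_eq_var (ts 1)
    obtain ⟨B, hB, h⟩ := hmem i j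
    refine ⟨B, hB, fun s => (h s).trans ?_⟩
    change _ ↔ ((ts 0).realize _ : Vt δ).1 ∈ ((ts 1).realize _ : Vt δ).1
    rw [hi, hj]
    rfl
  | imp φ ψ ihφ ihψ =>
    obtain ⟨B, hB, h⟩ := ihφ
    obtain ⟨C, hC, h'⟩ := ihψ
    obtain ⟨E, hE, h''⟩ := himp B hB C hC
    exact ⟨E, hE, fun s => by rw [h'', h, h', BoundedFormula.realize_imp]⟩
  | @all n φ ih =>
    obtain ⟨B, hB, h⟩ := ih
    obtain ⟨C, hC, h'⟩ := hall B hB n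
    refine ⟨C, hC, fun s => ?_⟩
    simp only [h', h, BoundedFormula.realize_all, snoc_eq_update]

theorem IsElemSub.velem {β δ : Ordinal.{0}} (hδ : Order.IsSuccLimit δ) (hβ : 0 < β) (hβδ : β ≤ δ)
    (h : IsElemSub Ordinal.omega0.toZFSet (V_ β) (V_ δ)) : VElem β δ := by
  obtain ⟨D, -, hD, htv⟩ := h
  rw [tarskiVaught_iff hδ] at htv
  refine velem_of_exists hβδ fun n φ x hx a ha => ?_
  obtain ⟨B, hB, h⟩ := hD.exists_mem hδ φ
  let s (m : ℕ) : Vt δ := if hm : m < n then x ⟨m, hm⟩ else ⟨∅, by simpa using hδ.bot_lt⟩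
  have hs : (fun i : Fin n => s i) = x := by
    ext i
    simp [s]
  have key (c : Vt δ) : code (Function.update s n c) ∈ B ↔
      φ.Realize default (Fin.snoc x c : _ → Vt δ) := by
    rw [h, ← hs, snoc_eq_update]
  obtain ⟨b, hb, hφ⟩ := htv B hB n (Function.update s n a) ((key a).2 ha) fun j hj => by
    rw [Function.update_of_ne hj]
    by_cases hm : j < n
    · simpa [s, hm] using hx ⟨j, hm⟩
    · simpa [s, hm] using hβ
  rw [Function.update_idem, key] at hφ
  exact ⟨b, hb, hφ⟩

/-- Universal quantification over the free variable `i`. -/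
def allAt (i : ℕ) (φ : LSet.Formula ℕ) : LSet.Formula ℕ :=
  (BoundedFormula.relabel (fun j => if j = i then Sum.inr 0 else Sum.inl j) φ :
    LSet.BoundedFormula ℕ (1 + 0)).all

theorem realize_allAt {M : Type*} [LSet.Structure M] {i : ℕ} {φ : LSet.Formula ℕ} {s : ℕ → M} :
    (allAt i φ).Realize s ↔ ∀ a, φ.Realize (Function.update s i a) := by
  rw [allAt, Formula.Realize, BoundedFormula.realize_all]
  refine forall_congr' fun a => ?_
  rw [BoundedFormula.realize_relabel, Formula.Realize]
  refine iff_of_eq (congrArg₂ _ ?_ (Subsingleton.elim _ _))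
  ext j
  by_cases hj : j = i
  · subst hj
    simp
    rfl
  · simp [hj]

theorem VElem.isElemSub {β δ : Ordinal.{0}} (hδ : Order.IsSuccLimit δ) (hβ : 0 < β)
    (hβδ : β ≤ δ) (h : VElem β δ) : IsElemSub Ordinal.omega0.toZFSet (V_ β) (V_ δ) := by
  let D : ZFSet.{0} := ZFSet.sep
    (fun B => ∃ φ : LSet.Formula ℕ, ∀ s : ℕ → Vt δ, code s ∈ B ↔ φ.Realize s)
    (V_ δ).powerset.powerset
  have hD (φ : LSet.Formula ℕ) : ∃ B ∈ D, ∀ s : ℕ → Vt δ, code s ∈ B ↔ φ.Realize s := by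
    have key (s : ℕ → Vt δ) : code s ∈ ZFSet.sep
        (fun c => ∃ s : ℕ → Vt δ, c = code s ∧ φ.Realize s) (V_ δ).powerset ↔ φ.Realize s := by
      rw [ZFSet.mem_sep, ZFSet.mem_powerset]
      refine ⟨?_, fun hs => ⟨code_subset hδ s, s, rfl, hs⟩⟩
      rintro ⟨_, s', hs', hφ⟩
      obtain rfl := code_injective hs'
      exact hφ
    refine ⟨_, ZFSet.mem_sep.2 ⟨?_, φ, key⟩, key⟩
    rw [ZFSet.mem_powerset]
    exact ZFSet.sep_subset
  have hD' {B : ZFSet.{0}} (hB : B ∈ D) :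
      ∃ φ : LSet.Formula ℕ, ∀ s : ℕ → Vt δ, code s ∈ B ↔ φ.Realize s := (ZFSet.mem_sep.1 hB).2
  refine ⟨D, ZFSet.sep_subset, (isLogicallyClosed_iff hδ).2 ⟨fun i j => ?_, fun i j => ?_, ?_,
    fun B hB C hC => ?_, fun B hB i => ?_⟩, (tarskiVaught_iff hδ).2 fun B hB i s hs hsb => ?_⟩
  · obtain ⟨B, hB, h⟩ := hD (Relations.formula₂ (L := LSet) adj (.var i) (.var j))
    refine ⟨B, hB, fun s => (h s).trans ?_⟩
    rw [Formula.realize_rel₂]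
    rfl
  · obtain ⟨B, hB, h⟩ := hD (Term.equal (.var i) (.var j))
    exact ⟨B, hB, fun s => (h s).trans (by rw [Formula.realize_equal]; rfl)⟩
  · obtain ⟨B, hB, h⟩ := hD ⊥
    exact ⟨B, hB, fun s => by simp [h]⟩
  · obtain ⟨φ, hφ⟩ := hD' hB
    obtain ⟨ψ, hψ⟩ := hD' hC
    obtain ⟨E, hE, h⟩ := hD (φ.imp ψ)
    exact ⟨E, hE, fun s => by rw [h, hφ, hψ, Formula.realize_imp]⟩
  · obtain ⟨φ, hφ⟩ := hD' hB
    obtain ⟨C, hC, h⟩ := hD (allAt i φ)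
    exact ⟨C, hC, fun s => by simp only [h, hφ, realize_allAt]⟩
  · obtain ⟨φ, hφ⟩ := hD' hB
    let x (j : ℕ) : Vt β := if hj : j ≠ i then ⟨s j, hsb j hj⟩ else ⟨∅, by simpa using hβ⟩
    have hx (a : Vt β) : inclusion hβδ ∘ Function.update x i a =
        Function.update s i (inclusion hβδ a) := by
      ext j
      by_cases hj : j = i
      · subst hj
        simp
      · simp [x, hj]
        rfl
    have hnot : ¬ (allAt i φ.not).Realize x := by
      rw [Formula.Realize, ← h.realize_iff hβδ,
        Subsingleton.elim (inclusion hβδ ∘ default) default]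
      change ¬ (allAt i φ.not).Realize (inclusion hβδ ∘ x)
      rw [realize_allAt]
      push Not
      refine ⟨s i, ?_⟩
      rw [Formula.realize_not, not_not, ← Function.update_eq_self i x, hx, Function.update_idem,
        Function.update_eq_self, ← hφ]
      exact hs
    rw [realize_allAt] at hnot
    push Not at hnot
    obtain ⟨a, ha⟩ := hnot
    rw [Formula.realize_not, not_not, Formula.Realize, ← h.realize_iff hβδ,
      Subsingleton.elim (inclusion hβδ ∘ default) default, hx] at ha
    exact ⟨inclusion hβδ a, a.2, (hφ _).2 ha⟩

/-! ### Reflection below an inaccessible cardinal -/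

instance : Countable LSet.Symbols := by
  have : IsEmpty (Σ l, LSet.Functions l) := ⟨fun f => f.2.elim⟩
  have : Countable (Σ l, LSet.Relations l) :=
    Function.Injective.countable (f := Sigma.fst) fun ⟨l, r⟩ ⟨l', r'⟩ h => by
      cases r; cases r'; rfl
  exact inferInstanceAs (Countable ((Σ l, LSet.Functions l) ⊕ Σ l, LSet.Relations l))

theorem IsInaccOrd.mk_formula_tuple_lt {γ : Ordinal.{0}} (hγ : IsInaccOrd γ) {x : ZFSet.{0}}
    (hx : x.rank < γ) :
    Cardinal.mk (Σ p : (Σ n, LSet.BoundedFormula Empty (n + 1)), Fin p.1 → Shrink.{0} x) <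
      γ.card := by
  have : Countable (Σ n, LSet.BoundedFormula Empty (n + 1)) :=
    Function.Injective.countable
      (f := fun p => (⟨p.1 + 1, p.2⟩ : Σ n, LSet.BoundedFormula Empty n)) fun ⟨n, φ⟩ ⟨m, ψ⟩ h => by
        obtain ⟨h₁, h₂⟩ := Sigma.mk.inj h
        obtain rfl := Nat.succ_injective h₁
        exact Sigma.ext rfl h₂
  rw [Cardinal.mk_sigma]
  refine Cardinal.sum_lt_of_isRegular hγ.1.isRegular
    (Cardinal.mk_le_aleph0.trans_lt hγ.1.aleph0_lt) fun p => ?_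
  rw [← Cardinal.power_def, Cardinal.mk_fin]
  exact Cardinal.power_nat_le_max.trans_lt (max_lt (hγ.card_lt hx) hγ.1.aleph0_lt)

theorem IsInaccOrd.exists_witness_bound {γ : Ordinal.{0}} (hγ : IsInaccOrd γ) {α : Ordinal.{0}}
    (hα : α < γ) : ∃ μ < γ, ∀ (n : ℕ) (φ : LSet.BoundedFormula Empty (n + 1)) (x : Fin n → Vt γ),
      (∀ i, (x i : ZFSet).rank < α) → ∀ a, φ.Realize default (Fin.snoc x a : _ → Vt γ) →
        ∃ b : Vt γ, (b : ZFSet).rank < μ ∧ φ.Realize default (Fin.snoc x b : _ → Vt γ) := by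
  have hV : (V_ α).rank < γ := by rwa [ZFSet.rank_vonNeumann]
  let T := Σ p : (Σ n, LSet.BoundedFormula Empty (n + 1)), Fin p.1 → Shrink.{0} (V_ α)
  let tuple (t : T) (i : Fin t.1.1) : Vt γ :=
    ⟨((equivShrink (V_ α)).symm (t.2 i)).1,
      (ZFSet.mem_vonNeumann.1 ((equivShrink (V_ α)).symm (t.2 i)).2).trans hα⟩
  have hex (t : T) : ∃ b : Vt γ, ∀ a, t.1.2.Realize default (Fin.snoc (tuple t) a : _ → Vt γ) →
      t.1.2.Realize default (Fin.snoc (tuple t) b : _ → Vt γ) := by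
    by_cases h : ∃ a, t.1.2.Realize default (Fin.snoc (tuple t) a : _ → Vt γ)
    · exact ⟨h.choose, fun _ _ => h.choose_spec⟩
    · exact ⟨⟨∅, by simpa using hγ.isSuccLimit.bot_lt⟩, fun a ha => (h ⟨a, ha⟩).elim⟩
  choose W hW using hex
  refine ⟨_, Ordinal.iSup_add_one_lt_of_lt_cof
    ((hγ.mk_formula_tuple_lt hV).trans_le hγ.card_le_cof) fun t => (W t).2,
    fun n φ x hx a ha => ?_⟩
  let t : T := ⟨⟨n, φ⟩, fun i => equivShrink (V_ α) ⟨x i, ZFSet.mem_vonNeumann.2 (hx i)⟩⟩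
  have ht : tuple t = x := by
    ext i
    simp [tuple, t]
  refine ⟨W t, (lt_add_one _).trans_le
    (Ordinal.le_iSup (fun t : T => (W t : ZFSet).rank + 1) t), ?_⟩
  simpa only [ht] using hW t a (by simpa only [ht] using ha)

theorem IsInaccOrd.exists_reflecting {γ : Ordinal.{0}} (hγ : IsInaccOrd γ) {η : Ordinal.{0}}
    (hη : η < γ) : ∃ δ, η < δ ∧ δ < γ ∧ Order.IsSuccLimit δ ∧ VElem δ γ ∧
      ∀ x : ZFSet.{0}, x.rank < δ → x.card < δ.card := by
  have step (α : Set.Iio γ) : ∃ μ : Set.Iio γ, α < μ ∧ (V_ α.1).card < μ.1.card ∧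
      ∀ (n : ℕ) (φ : LSet.BoundedFormula Empty (n + 1)) (x : Fin n → Vt γ),
        (∀ i, (x i : ZFSet).rank < α) → ∀ a, φ.Realize default (Fin.snoc x a : _ → Vt γ) →
        ∃ b : Vt γ, (b : ZFSet).rank < μ ∧ φ.Realize default (Fin.snoc x b : _ → Vt γ) := by
    obtain ⟨μ, hμ, h⟩ := hγ.exists_witness_bound α.2
    have hc : (Order.succ (V_ α.1).card).ord < γ := by
      refine (Cardinal.ord_lt_ord.2 (hγ.1.isSuccLimit.succ_lt (hγ.card_lt ?_))).trans_eq hγ.2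
      rw [ZFSet.rank_vonNeumann]
      exact α.2
    refine ⟨⟨max μ (max (Order.succ α.1) (Order.succ (V_ α.1).card).ord),
      max_lt hμ (max_lt (hγ.isSuccLimit.succ_lt α.2) hc)⟩, ?_, ?_, fun n φ x hx a ha => ?_⟩
    · exact (Order.lt_succ α.1).trans_le ((le_max_left _ _).trans (le_max_right _ _))
    · exact (Order.lt_succ _).trans_le ((Cardinal.card_ord _).symm.trans_le <|
        Ordinal.card_le_card ((le_max_right _ _).trans (le_max_right _ _)))
    · obtain ⟨b, hb, hφ⟩ := h n φ x hx a ha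
      exact ⟨b, hb.trans_le (le_max_left _ _), hφ⟩
  choose g hlt hcard hwit using step
  let s (n : ℕ) : Set.Iio γ := g^[n] ⟨η, hη⟩
  have hs (n : ℕ) : s (n + 1) = g (s n) := Function.iterate_succ_apply' g n _
  have hmono : StrictMono s := strictMono_nat_of_lt_succ fun n => hs n ▸ hlt _
  let δ : Ordinal.{0} := ⨆ n, (s n).1
  have hle (n : ℕ) : (s n).1 ≤ δ := Ordinal.le_iSup (fun n => (s n).1) n
  have hsδ (n : ℕ) : (s n).1 < δ := (Subtype.coe_lt_coe.2 (hmono n.lt_succ_self)).trans_le (hle _)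
  have hδ {α : Ordinal.{0}} (hα : α < δ) : ∃ n, α < (s n).1 := Ordinal.lt_iSup_iff.1 hα
  have hδγ : δ < γ := Ordinal.iSup_lt_of_lt_cof
    (by simpa using hγ.1.aleph0_lt.trans_le hγ.card_le_cof) fun n => (s n).2
  refine ⟨δ, hsδ 0, hδγ, ?_, velem_of_exists hδγ.le fun n φ x hx a ha => ?_, fun x hx => ?_⟩
  · rw [Ordinal.isSuccLimit_iff, Order.isSuccPrelimit_iff_succ_lt]
    refine ⟨(hsδ 0).ne_bot, fun α hα => ?_⟩
    obtain ⟨n, hn⟩ := hδ hα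
    exact (Order.succ_le_of_lt hn).trans_lt (hsδ n)
  · choose m hm using fun i => hδ (hx i)
    obtain ⟨N, hN⟩ := Finite.bddAbove_range m
    obtain ⟨b, hb, hφ⟩ := hwit (s N) n φ x
      (fun i => (hm i).trans_le (hmono.monotone (hN (Set.mem_range_self i)))) a ha
    exact ⟨b, hb.trans_le (hs N ▸ hle _), hφ⟩
  · obtain ⟨n, hn⟩ := hδ hx
    refine (ZFSet.card_mono (y := V_ (s n).1) ?_).trans_lt ((hcard (s n)).trans_le ?_)
    · rw [ZFSet.subset_vonNeumann]
      exact hn.le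
    · exact Ordinal.card_le_card (hs n ▸ hle _)

/-! ### Elementary extensions inside a level -/

/-- `b` is a regular level containing `t` which, from the point of view of `V_γ`, has unboundedly
many elementary extensions that are levels of cardinal height. -/
def HasExtensionsIn (γ : Ordinal.{0}) (t w b : ZFSet.{0}) : Prop :=
  t ∈ b ∧ IsRegularLevel b ∧
    ∀ η : Vt γ, ∃ d : Vt γ, (η : ZFSet) ∈ (d : ZFSet) ∧ IsCardinalLevel d ∧ IsElemSub w b d

theorem exists_formula_hasExtensionsIn : ∃ χ : LSet.BoundedFormula Empty 3,
    ∀ γ : Ordinal.{0}, Order.IsSuccLimit γ → ∀ v : Fin 3 → Vt γ,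
      χ.Realize default v ↔ HasExtensionsIn γ (v 0) (v 1) (v 2) := by
  obtain ⟨φ, hφ⟩ : IsAbsolute fun v : Fin 3 → ZFSet => v 0 ∈ v 2 ∧ IsRegularLevel (v 2) :=
    .and (.mem (.proj _) (.proj _)) (.isRegularLevel (.proj _))
  obtain ⟨ψ, hψ⟩ : IsAbsolute fun v : Fin 5 → ZFSet =>
      v 3 ∈ v 4 ∧ IsCardinalLevel (v 4) ∧ IsElemSub (v 1) (v 2) (v 4) :=
    .and (.mem (.proj _) (.proj _)) (.and (.isCardinalLevel (.proj _))
      (.isElemSub (.proj _) (.proj _) (.proj _)))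
  refine ⟨φ ⊓ ψ.ex.all, fun γ hγ v => ?_⟩
  simp only [BoundedFormula.realize_inf, BoundedFormula.realize_all, BoundedFormula.realize_ex,
    hφ γ hγ, hψ γ hγ, HasExtensionsIn, and_assoc]
  rfl

theorem VElem.hasExtensionsIn_iff {κ γ : Ordinal.{0}} (h : VElem κ γ) (hκγ : κ ≤ γ)
    (hκ : Order.IsSuccLimit κ) (hγ : Order.IsSuccLimit γ) (t w b : Vt κ) :
    HasExtensionsIn γ t w b ↔ HasExtensionsIn κ t w b := by
  obtain ⟨χ, hχ⟩ := exists_formula_hasExtensionsIn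
  have := h.realize_iff hκγ χ default ![t, w, b]
  rw [Subsingleton.elim (inclusion hκγ ∘ default) default, hχ γ hγ, hχ κ hκ] at this
  exact this

theorem VElem.exists_hasExtensionsIn_iff {κ γ : Ordinal.{0}} (h : VElem κ γ) (hκγ : κ ≤ γ)
    (hκ : Order.IsSuccLimit κ) (hγ : Order.IsSuccLimit γ) (t w : Vt κ) :
    (∃ b : Vt γ, HasExtensionsIn γ t w b) ↔ ∃ b : Vt κ, HasExtensionsIn κ t w b := by
  obtain ⟨χ, hχ⟩ := exists_formula_hasExtensionsIn
  have := h.realize_iff hκγ χ.ex default ![t, w]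
  simp only [Subsingleton.elim (inclusion hκγ ∘ default) default, BoundedFormula.realize_ex,
    hχ γ hγ, hχ κ hκ] at this
  exact this

theorem IsInaccOrd.hasExtensionsIn {κ γ τ : Ordinal.{0}} (hκ : IsInaccOrd κ) (hγ : IsInaccOrd γ)
    (hκγ : κ < γ) (h : VElem κ γ) (hτ : τ < κ) :
    HasExtensionsIn γ (V_ τ) Ordinal.omega0.toZFSet (V_ κ) := by
  refine ⟨ZFSet.vonNeumann_mem_of_lt hτ, hκ.isRegularLevel, fun η => ?_⟩
  obtain ⟨δ, hδ, hδγ, hlim, hδe, hcard⟩ := hγ.exists_reflecting (max_lt hκγ η.2)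
  have hκδ : κ < δ := (le_max_left _ _).trans_lt hδ
  exact ⟨⟨V_ δ, by rwa [ZFSet.rank_vonNeumann]⟩,
    ZFSet.mem_vonNeumann.2 ((le_max_right _ _).trans_lt hδ),
    isCardinalLevel_vonNeumann hlim hcard,
    (h.of_velem_of_le hδe hκδ.le hδγ.le).isElemSub hlim hκ.isSuccLimit.bot_lt hκδ.le⟩

theorem HasExtensionsIn.exists_velem {β γ η : Ordinal.{0}} {t : ZFSet.{0}} (hβ : 0 < β)
    (hβη : β ≤ η) (hη : η < γ)
    (h : HasExtensionsIn γ t Ordinal.omega0.toZFSet (V_ β)) :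
    ∃ δ, IsCardOrd δ ∧ η < δ ∧ VElem β δ := by
  obtain ⟨⟨d, _⟩, hηd, hd, hsub⟩ := h.2.2 ⟨V_ η, by rwa [ZFSet.rank_vonNeumann]⟩
  obtain ⟨δ, rfl⟩ : ∃ δ, d = V_ δ := ⟨_, hd.eq_vonNeumann⟩
  have hlt : η < δ := by simpa using ZFSet.mem_vonNeumann.1 hηd
  exact ⟨δ, hd.isCardOrd hlt, hlt,
    hsub.velem (isSuccLimit_of_forall_mem hlt hd.2) hβ (hβη.trans hlt.le)⟩

/-- Every uplifting cardinal is pseudo uplifting and a limit of pseudo uplifting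
cardinals. -/
theorem uplifting_pseudoUplifting_limit (κ : Ordinal) (h : IsUplifting κ) :
    IsPseudoUplifting κ ∧ ∀ θ < κ, ∃ β : Ordinal, θ < β ∧ β < κ ∧ IsPseudoUplifting β := by
  obtain ⟨hκ, hup⟩ := h
  refine ⟨⟨hκ, fun θ => ?_⟩, fun θ hθ => ?_⟩
  · obtain ⟨γ, hγ, hθγ, hκγ, he⟩ := hup θ
    exact ⟨γ, hγ.2, hθγ, hκγ, he⟩
  have hτ : max θ Ordinal.omega0 < κ := max_lt hθ hκ.omega0_lt
  let t : Vt κ := ⟨V_ (max θ Ordinal.omega0), by rwa [ZFSet.rank_vonNeumann]⟩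
  let w : Vt κ := ⟨Ordinal.omega0.toZFSet, by
    rw [Ordinal.rank_toZFSet]; exact hκ.omega0_lt⟩
  obtain ⟨γ, hγ, -, hκγ, he⟩ := hup 0
  obtain ⟨⟨b, hbκ⟩, hb⟩ :=
    (he.exists_hasExtensionsIn_iff hκγ.le hκ.isSuccLimit hγ.isSuccLimit t w).1
      ⟨⟨V_ κ, by rwa [ZFSet.rank_vonNeumann]⟩, hκ.hasExtensionsIn hγ hκγ he hτ⟩
  obtain ⟨β, rfl⟩ : ∃ β, b = V_ β := ⟨_, hb.2.1.eq_vonNeumann⟩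
  have hτβ : max θ Ordinal.omega0 < β := by simpa [t] using ZFSet.rank_lt_of_mem hb.1
  obtain ⟨hθβ, hωβ⟩ := max_lt_iff.1 hτβ
  have hβκ : β < κ := by simpa using hbκ
  refine ⟨β, hθβ, hβκ, hb.2.1.isInaccOrd hωβ, fun θ' => ?_⟩
  obtain ⟨γ', hγ', hle, hκγ', he'⟩ := hup (Order.succ (max θ' β))
  obtain ⟨δ, hδ, hlt, hδe⟩ :=
    ((he'.hasExtensionsIn_iff hκγ'.le hκ.isSuccLimit hγ'.isSuccLimit t w ⟨V_ β, hbκ⟩).2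
      hb).exists_velem (Ordinal.omega0_pos.trans hωβ) (le_max_right θ' _)
      (Order.succ_le_iff.1 hle)
  exact ⟨δ, hδ, (le_max_left _ _).trans hlt.le, (le_max_right _ _).trans_lt hlt, hδe⟩

end Paper
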